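/- arXiv:1811.04340 — 3 statements merged into one kernel-verified Lean document; each statement's English description precedes it below -/
import Mathlib

section
/- Let E and F be finite-dimensional real normed spaces and Φ : E → F a map that is Lipschitz with constant L. Then for every p ∈ E the mixture K_Φ(p) of the differential of Φ at p is nonempty, and every G ∈ K_Φ(p) satisfies ‖G‖ ≤ L in the operator norm. -/
open Filter Topology

/-- The mixture of the differential of a Lipschitz map `Φ` at `p`: all operator-norm limits
of `fderiv ℝ Φ xᵢ` along sequences of differentiability points `xᵢ → p`. -/
def mixture {E F : Type*} [NormedAddCommGroup E] [NormedSpace ℝ E]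
    [NormedAddCommGroup F] [NormedSpace ℝ F] (Φ : E → F) (p : E) :
    Set (E →L[ℝ] F) :=
  {G : E →L[ℝ] F | ∃ x : ℕ → E, (∀ i, DifferentiableAt ℝ Φ (x i)) ∧
    Tendsto x atTop (𝓝 p) ∧ Tendsto (fun i => fderiv ℝ Φ (x i)) atTop (𝓝 G)}

/-- **Rademacher's theorem**, density form: the differentiability points of a Lipschitz map between
finite-dimensional spaces are dense. -/
theorem LipschitzWith.dense_differentiableAt {E F : Type*}
    [NormedAddCommGroup E] [NormedSpace ℝ E] [FiniteDimensional ℝ E]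
    [NormedAddCommGroup F] [NormedSpace ℝ F] [FiniteDimensional ℝ F]
    {Φ : E → F} {L : NNReal} (hΦ : LipschitzWith L Φ) :
    Dense {x | DifferentiableAt ℝ Φ x} := by
  borelize E
  let b := Module.finBasis ℝ E
  exact MeasureTheory.Measure.dense_of_ae (hΦ.ae_differentiableAt (μ := b.addHaar))

theorem stmt_2 {E F : Type*}
    [NormedAddCommGroup E] [NormedSpace ℝ E] [FiniteDimensional ℝ E]
    [NormedAddCommGroup F] [NormedSpace ℝ F] [FiniteDimensional ℝ F]
    (Φ : E → F) (L : NNReal) (hΦ : LipschitzWith L Φ) (p : E) :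
    (mixture Φ p).Nonempty ∧ ∀ G ∈ mixture Φ p, ‖G‖ ≤ (L : ℝ) := by
  have hbound : ∀ x, ‖fderiv ℝ Φ x‖ ≤ L := fun x => norm_fderiv_le_of_lipschitz ℝ hΦ
  refine ⟨?_, ?_⟩
  · obtain ⟨x, hx, hxp⟩ :=
      mem_closure_iff_seq_limit.1 (hΦ.dense_differentiableAt.closure_eq ▸ Set.mem_univ p)
    obtain ⟨G, -, φ, hφ, hG⟩ := (isCompact_closedBall (0 : E →L[ℝ] F) L).tendsto_subseq
      (x := fun i => fderiv ℝ Φ (x i)) fun i => mem_closedBall_zero_iff.2 (hbound _)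
    exact ⟨G, x ∘ φ, fun i => hx (φ i), hxp.comp hφ.tendsto_atTop, hG⟩
  · rintro G ⟨x, -, -, hG⟩
    exact le_of_tendsto hG.norm (Eventually.of_forall fun i => hbound (x i))
end

section
/- Let E and F be finite-dimensional real normed spaces and Φ : E → F a Lipschitz map. Then the Clarke generalized differential is upper semicontinuous: for every p ∈ E and every ε > 0 there is μ > 0 such that for all x ∈ E with ‖x − p‖ < μ, every h ∈ ∂Φ(x) lies within operator-norm distance ε of some g ∈ ∂Φ(p). -/
open Filter Topology

/-- The Clarke generalized differential of `Φ` at `p`. -/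
def clarke {E F : Type*} [NormedAddCommGroup E] [NormedSpace ℝ E]
    [NormedAddCommGroup F] [NormedSpace ℝ F] (Φ : E → F) (p : E) :
    Set (E →L[ℝ] F) :=
  convexHull ℝ (mixture Φ p)

/-- Differentials at differentiability points close to `p` are close to the mixture at `p`. -/
theorem exists_fderiv_mem_thickening_mixture {E F : Type*}
    [NormedAddCommGroup E] [NormedSpace ℝ E] [FiniteDimensional ℝ E]
    [NormedAddCommGroup F] [NormedSpace ℝ F] [FiniteDimensional ℝ F]
    {Φ : E → F} {L : NNReal} (hΦ : LipschitzWith L Φ) (p : E) {ε : ℝ} (hε : 0 < ε) :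
    ∃ μ > (0 : ℝ), ∀ y : E, DifferentiableAt ℝ Φ y → dist y p < μ →
      fderiv ℝ Φ y ∈ Metric.thickening ε (mixture Φ p) := by
  by_contra! H
  choose y hyd hyp hy using fun n : ℕ => H (1 / ((n : ℝ) + 1)) Nat.one_div_pos_of_nat
  have hyt : Tendsto y atTop (𝓝 p) :=
    tendsto_iff_dist_tendsto_zero.2 <| squeeze_zero (fun _ => dist_nonneg)
      (fun n => (hyp n).le) tendsto_one_div_add_atTop_nhds_zero_nat
  have : ProperSpace (E →L[ℝ] F) := FiniteDimensional.proper ℝ _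
  obtain ⟨G, -, φ, hφ, hG⟩ := (isCompact_closedBall (0 : E →L[ℝ] F) L).tendsto_subseq
    (x := fun n => fderiv ℝ Φ (y n))
    fun n => mem_closedBall_zero_iff.2 (norm_fderiv_le_of_lipschitz ℝ hΦ)
  have hGm : G ∈ mixture Φ p :=
    ⟨y ∘ φ, fun i => hyd (φ i), hyt.comp hφ.tendsto_atTop, hG⟩
  obtain ⟨n, hn⟩ := (hG.eventually (Metric.ball_mem_nhds G hε)).exists
  exact hy (φ n) (Metric.mem_thickening_iff.2 ⟨G, hGm, hn⟩)

/-- Upper semicontinuity of the Clarke generalized differential. -/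
theorem stmt_5 {E F : Type*}
    [NormedAddCommGroup E] [NormedSpace ℝ E] [FiniteDimensional ℝ E]
    [NormedAddCommGroup F] [NormedSpace ℝ F] [FiniteDimensional ℝ F]
    (Φ : E → F) (L : NNReal) (hΦ : LipschitzWith L Φ) :
    ∀ p : E, ∀ ε > (0 : ℝ), ∃ μ > (0 : ℝ), ∀ x : E, ‖x - p‖ < μ →
      ∀ h ∈ clarke Φ x, ∃ g ∈ clarke Φ p, ‖h - g‖ ≤ ε := by
  intro p ε hε
  obtain ⟨μ, hμ, H⟩ := exists_fderiv_mem_thickening_mixture hΦ p (half_pos hε)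
  refine ⟨μ, hμ, fun x hx h hh => ?_⟩
  have hsub : mixture Φ x ⊆ Metric.thickening ε (clarke Φ p) := by
    rintro G ⟨y, hyd, hyx, hyG⟩
    have hy : ∀ᶠ i in atTop, y i ∈ Metric.ball p μ :=
      hyx.eventually (Metric.isOpen_ball.mem_nhds (mem_ball_iff_norm.2 hx))
    obtain ⟨i, hi, hiG⟩ :=
      (hy.and (hyG.eventually (Metric.ball_mem_nhds G (half_pos hε)))).exists
    obtain ⟨g, hg, hgi⟩ := Metric.mem_thickening_iff.1 (H (y i) (hyd i) hi)
    refine Metric.mem_thickening_iff.2 ⟨g, subset_convexHull ℝ _ hg, ?_⟩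
    have hGi : dist G (fderiv ℝ Φ (y i)) < ε / 2 := by
      rw [dist_comm]
      exact hiG
    linarith [dist_triangle G (fderiv ℝ Φ (y i)) g]
  obtain ⟨g, hg, hhg⟩ := Metric.mem_thickening_iff.1
    (convexHull_min hsub ((convex_convexHull ℝ _).thickening ε) hh)
  exact ⟨g, hg, (dist_eq_norm h g).symm.trans_le hhg.le⟩
end

section
/- Let E and F be finite-dimensional real inner product spaces with 1 ≤ dim E = m ≤ n = dim F, and let Φ : E → F be a Lipschitz map. If p ∈ E is nonsingular for Φ in the sense of Clarke (every g ∈ ∂Φ(p) is injective), then there exist constants λ > 0 and δ > 0 such that: (1) for every unit vector u ∈ E and every x in the open ball B(p, 2λ) there is a unit vector V ∈ F with ⟪g(u), V⟫ ≥ δ for all g ∈ ∂Φ(x); and (2) every point x ∈ B(p, 2λ) is nonsingular for Φ. -/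
open Filter Topology
open scoped RealInnerProductSpace

/-- Every element of the mixture of an `L`-Lipschitz map has norm at most `L`. -/
theorem norm_le_of_mem_mixture {E F : Type*} [NormedAddCommGroup E] [NormedSpace ℝ E]
    [NormedAddCommGroup F] [NormedSpace ℝ F] {Φ : E → F} {L : NNReal}
    (hΦ : LipschitzWith L Φ) {p : E} {G : E →L[ℝ] F} (hG : G ∈ mixture Φ p) : ‖G‖ ≤ L := by
  obtain ⟨x, -, -, hG⟩ := hG
  exact le_of_tendsto hG.norm (Eventually.of_forall fun i => norm_fderiv_le_of_lipschitz ℝ hΦ)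

theorem mem_mixture_iff_mem_closure {E F : Type*} [NormedAddCommGroup E] [NormedSpace ℝ E]
    [NormedAddCommGroup F] [NormedSpace ℝ F] {Φ : E → F} {p : E} {G : E →L[ℝ] F} :
    G ∈ mixture Φ p ↔
      (p, G) ∈ closure ((fun x => (x, fderiv ℝ Φ x)) '' {x | DifferentiableAt ℝ Φ x}) := by
  rw [mem_closure_iff_seq_limit]
  constructor
  · rintro ⟨x, hx, hxp, hxG⟩
    exact ⟨fun i => (x i, fderiv ℝ Φ (x i)), fun i => ⟨x i, hx i, rfl⟩, hxp.prodMk_nhds hxG⟩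
  · rintro ⟨y, hy, hyp⟩
    choose x hx hxy using hy
    obtain rfl : (fun i => (x i, fderiv ℝ Φ (x i))) = y := funext hxy
    exact ⟨x, hx, (continuous_fst.tendsto _).comp hyp, (continuous_snd.tendsto _).comp hyp⟩

theorem isCompact_mixture {E F : Type*} [NormedAddCommGroup E] [NormedSpace ℝ E]
    [FiniteDimensional ℝ E] [NormedAddCommGroup F] [NormedSpace ℝ F] [FiniteDimensional ℝ F]
    {Φ : E → F} {L : NNReal} (hΦ : LipschitzWith L Φ) (p : E) : IsCompact (mixture Φ p) := by
  have : ProperSpace (E →L[ℝ] F) := FiniteDimensional.proper ℝ _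
  refine (isCompact_closedBall (0 : E →L[ℝ] F) L).of_isClosed_subset ?_ fun G hG => by
    simpa using norm_le_of_mem_mixture hΦ hG
  have : mixture Φ p = (fun G => (p, G)) ⁻¹'
      closure ((fun x => (x, fderiv ℝ Φ x)) '' {x | DifferentiableAt ℝ Φ x}) :=
    Set.ext fun G => mem_mixture_iff_mem_closure
  rw [this]
  exact isClosed_closure.preimage (by fun_prop)

/-- In a finite-dimensional space, the convex hull of a compact set is compact. -/
theorem IsCompact.convexHull_of_finiteDimensional {V : Type*} [NormedAddCommGroup V]
    [NormedSpace ℝ V] [FiniteDimensional ℝ V] {s : Set V} (hs : IsCompact s) :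
    IsCompact (convexHull ℝ s) := by
  have hcomp : IsCompact (⋃ n ∈ Set.Iic (Module.finrank ℝ V + 1),
      (fun q : (Fin n → ℝ) × (Fin n → V) => ∑ i, q.1 i • q.2 i) ''
        (stdSimplex ℝ (Fin n) ×ˢ Set.univ.pi fun _ => s)) :=
    (Set.finite_Iic _).isCompact_biUnion fun n _ =>
      ((isCompact_stdSimplex ℝ (Fin n)).prod (isCompact_univ_pi fun _ => hs)).image (by fun_prop)
  convert hcomp using 1
  apply Set.Subset.antisymm
  · intro x hx
    obtain ⟨ι, _, z, w, hz, hind, hw, hw1, rfl⟩ := eq_pos_convex_span_of_mem_convexHull hx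
    let e := Fintype.equivFin ι
    refine Set.mem_iUnion₂.mpr ⟨Fintype.card ι, ?_, (w ∘ e.symm, z ∘ e.symm), ⟨⟨?_, ?_⟩, ?_⟩, ?_⟩
    · exact hind.card_le_finrank_succ.trans (Nat.succ_le_succ (Submodule.finrank_le _))
    · exact fun i => (hw _).le
    · exact (e.symm.sum_comp w).trans hw1
    · exact fun i _ => hz (Set.mem_range_self _)
    · exact e.symm.sum_comp fun i => w i • z i
  · refine Set.iUnion₂_subset fun n _ => ?_
    rintro _ ⟨q, ⟨hq, hqs⟩, rfl⟩
    exact (convex_convexHull ℝ s).sum_mem (fun i _ => hq.1 i) hq.2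
      fun i _ => subset_convexHull ℝ s (hqs i trivial)

theorem isCompact_clarke {E F : Type*} [NormedAddCommGroup E] [NormedSpace ℝ E]
    [FiniteDimensional ℝ E] [NormedAddCommGroup F] [NormedSpace ℝ F] [FiniteDimensional ℝ F]
    {Φ : E → F} {L : NNReal} (hΦ : LipschitzWith L Φ) (p : E) : IsCompact (clarke Φ p) :=
  (isCompact_mixture hΦ p).convexHull_of_finiteDimensional

/-- Differentials at points close to `p` are close to the mixture at `p`. -/
theorem eventually_fderiv_mem_thickening {E F : Type*} [NormedAddCommGroup E] [NormedSpace ℝ E]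
    [FiniteDimensional ℝ E] [NormedAddCommGroup F] [NormedSpace ℝ F] [FiniteDimensional ℝ F]
    {Φ : E → F} {L : NNReal} (hΦ : LipschitzWith L Φ) (p : E) {ε : ℝ} (hε : 0 < ε) :
    ∀ᶠ x in 𝓝 p, DifferentiableAt ℝ Φ x → fderiv ℝ Φ x ∈ Metric.thickening ε (mixture Φ p) := by
  have : ProperSpace (E →L[ℝ] F) := FiniteDimensional.proper ℝ _
  by_contra h
  obtain ⟨x, hxp, hx⟩ := exists_seq_forall_of_frequently (not_eventually.mp h)
  push Not at hx
  obtain ⟨G, -, φ, hφ, hG⟩ := (isCompact_closedBall (0 : E →L[ℝ] F) L).tendsto_subseq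
    (x := fun i => fderiv ℝ Φ (x i)) fun i => by
      simpa using norm_fderiv_le_of_lipschitz ℝ hΦ
  have hGp : G ∈ mixture Φ p :=
    ⟨x ∘ φ, fun i => (hx _).1, hxp.comp hφ.tendsto_atTop, hG⟩
  obtain ⟨i, hi⟩ := (hG.eventually (Metric.isOpen_thickening.mem_nhds
    (Metric.self_subset_thickening hε _ hGp))).exists
  exact (hx (φ i)).2 hi

/-- The Clarke generalized differential of a Lipschitz map is upper semicontinuous. -/
theorem eventually_clarke_subset_cthickening {E F : Type*}
    [NormedAddCommGroup E] [NormedSpace ℝ E] [FiniteDimensional ℝ E]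
    [NormedAddCommGroup F] [NormedSpace ℝ F] [FiniteDimensional ℝ F]
    {Φ : E → F} {L : NNReal} (hΦ : LipschitzWith L Φ) (p : E) {ε : ℝ} (hε : 0 < ε) :
    ∀ᶠ x in 𝓝 p, clarke Φ x ⊆ Metric.cthickening ε (clarke Φ p) := by
  filter_upwards [(eventually_fderiv_mem_thickening hΦ p hε).eventually_nhds] with x hx
  refine convexHull_min ?_ ((convex_convexHull ℝ _).cthickening ε)
  rintro G ⟨y, hy, hyx, hyG⟩
  refine Metric.isClosed_cthickening.mem_of_tendsto hyG ?_
  filter_upwards [hyx.eventually hx] with i hi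
  exact Metric.cthickening_subset_of_subset ε (subset_convexHull ℝ _)
    (Metric.thickening_subset_cthickening _ _ (hi (hy i)))

/-- A closed convex set avoiding the open ball of radius `c > 0` about the origin lies in a
half-space at distance at least `c` from the origin. -/
theorem Convex.exists_norm_eq_one_forall_le_inner {F : Type*} [NormedAddCommGroup F]
    [InnerProductSpace ℝ F] [Nontrivial F] {S : Set F} (hS : Convex ℝ S) (hS' : IsComplete S)
    {c : ℝ} (hc : 0 < c) (h : ∀ s ∈ S, c ≤ ‖s‖) :
    ∃ V : F, ‖V‖ = 1 ∧ ∀ s ∈ S, c ≤ ⟪s, V⟫ := by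
  rcases S.eq_empty_or_nonempty with rfl | hne
  · obtain ⟨V, hV⟩ := exists_norm_eq F zero_le_one
    exact ⟨V, hV, by simp⟩
  obtain ⟨w, hwS, hw⟩ := exists_norm_eq_iInf_of_complete_convex hne hS' hS 0
  rw [norm_eq_iInf_iff_real_inner_le_zero hS hwS] at hw
  have hw0 : 0 < ‖w‖ := hc.trans_le (h w hwS)
  refine ⟨‖w‖⁻¹ • w, by rw [norm_smul, norm_inv, norm_norm, inv_mul_cancel₀ hw0.ne'],
    fun s hs => (h w hwS).trans ?_⟩
  have hsw := hw s hs
  rw [zero_sub, inner_neg_left, inner_sub_right, real_inner_self_eq_norm_sq,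
    real_inner_comm] at hsw
  rw [inner_smul_right, inv_mul_eq_div, le_div_iff₀ hw0]
  nlinarith

theorem stmt_10 {E F : Type*}
    [NormedAddCommGroup E] [InnerProductSpace ℝ E] [FiniteDimensional ℝ E]
    [NormedAddCommGroup F] [InnerProductSpace ℝ F] [FiniteDimensional ℝ F]
    (hm : 1 ≤ Module.finrank ℝ E) (hmn : Module.finrank ℝ E ≤ Module.finrank ℝ F)
    (Φ : E → F) (L : NNReal) (hΦ : LipschitzWith L Φ) (p : E)
    (hp : ∀ g ∈ clarke Φ p, Function.Injective g) :
    ∃ lam > (0 : ℝ), ∃ δ > (0 : ℝ),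
      (∀ u : E, ‖u‖ = 1 → ∀ x ∈ Metric.ball p (2 * lam), ∃ V : F, ‖V‖ = 1 ∧
        ∀ g ∈ clarke Φ x, δ ≤ ⟪g u, V⟫) ∧
      (∀ x ∈ Metric.ball p (2 * lam), ∀ g ∈ clarke Φ x, Function.Injective g) := by
  have : Nontrivial F := Module.nontrivial_of_finrank_pos (R := ℝ) (by lia)
  have hK := isCompact_clarke hΦ p
  obtain ⟨c, hc, hcK⟩ := (hK.prod (isCompact_sphere (0 : E) 1)).exists_forall_le'
    (f := fun q => ‖q.1 q.2‖) (a := 0) (by fun_prop) (by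
      rintro ⟨g, u⟩ ⟨hg, hu⟩
      have hu0 : u ≠ 0 := ne_zero_of_mem_unit_sphere ⟨u, hu⟩
      exact norm_pos_iff.mpr fun h => hu0 (hp g hg (by simpa using h)))
  obtain ⟨r, hr, hball⟩ := Metric.eventually_nhds_iff_ball.mp
    (eventually_clarke_subset_cthickening hΦ p (half_pos hc))
  have key : ∀ u : E, ‖u‖ = 1 → ∃ V : F, ‖V‖ = 1 ∧
      ∀ x ∈ Metric.ball p r, ∀ g ∈ clarke Φ x, c / 2 ≤ ⟪g u, V⟫ := by
    intro u hu
    let ev : (E →L[ℝ] F) →L[ℝ] F := ContinuousLinearMap.apply ℝ F u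
    obtain ⟨V, hV, hVK⟩ := ((convex_convexHull ℝ (mixture Φ p)).linear_image
      ev.toLinearMap).exists_norm_eq_one_forall_le_inner
      (hK.image ev.continuous).isComplete hc (by
        rintro _ ⟨g, hg, rfl⟩
        exact hcK (g, u) ⟨hg, by simpa using hu⟩)
    refine ⟨V, hV, fun x hx g hg => ?_⟩
    have hgK := hball x hx hg
    rw [hK.cthickening_eq_biUnion_closedBall (half_pos hc).le] at hgK
    obtain ⟨k, hk, hgk⟩ := Set.mem_iUnion₂.mp hgK
    have h1 : c ≤ ⟪k u, V⟫ := hVK _ ⟨k, hk, rfl⟩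
    have h2 : ⟪k u - g u, V⟫ ≤ c / 2 := by
      calc ⟪k u - g u, V⟫ ≤ ‖k u - g u‖ * ‖V‖ := real_inner_le_norm _ _
        _ = ‖(k - g) u‖ := by simp [hV]
        _ ≤ ‖k - g‖ * ‖u‖ := (k - g).le_opNorm u
        _ = dist g k := by rw [hu, mul_one, dist_comm, dist_eq_norm]
        _ ≤ c / 2 := hgk
    rw [inner_sub_left] at h2
    linarith
  refine ⟨r / 2, half_pos hr, c / 2, half_pos hc, ?_, ?_⟩ <;> rw [mul_div_cancel₀ r two_ne_zero]
  · intro u hu x hx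
    obtain ⟨V, hV, h⟩ := key u hu
    exact ⟨V, hV, h x hx⟩
  · intro x hx g hg
    refine (injective_iff_map_eq_zero g).mpr fun v hv => ?_
    by_contra hv0
    obtain ⟨V, -, h⟩ := key (‖v‖⁻¹ • v) (norm_smul_inv_norm (𝕜 := ℝ) hv0)
    have := h x hx g hg
    rw [map_smul, hv, smul_zero, inner_zero_left] at this
    linarith
end
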